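/- Let Y be a reflexive asymptotic-c₀ Banach space. If X is a Banach space whose closed unit ball B_X (with the norm metric) uniformly embeds into Y, then X is also reflexive and asymptotic-c₀. -/

import Mathlib

open Finset Filter

/-- A Banach space is reflexive if the canonical embedding into its bidual is surjective. -/
def IsReflexiveSpace (X : Type*) [NormedAddCommGroup X] [NormedSpace ℝ X] : Prop :=
  Function.Surjective (NormedSpace.inclusionInDoubleDual ℝ X)

/-- A closed subspace of finite codimension. -/
def FinCodimClosed {X : Type*} [NormedAddCommGroup X] [NormedSpace ℝ X]
    (Y : Submodule ℝ X) : Prop :=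
  IsClosed (Y : Set X) ∧ FiniteDimensional ℝ (X ⧸ Y)

/-- `(x₁,...,x_k)` is `D`-equivalent to the unit vector basis of `ℓ∞^k`. -/
def EquivLinftyBasis (D : ℝ) {X : Type*} [NormedAddCommGroup X] [NormedSpace ℝ X]
    {k : ℕ} (x : Fin k → X) : Prop :=
  ∃ A B : ℝ, 0 < A ∧ 0 < B ∧ A * B ≤ D ∧
    ∀ a : Fin k → ℝ,
      (1 / A) * (⨆ i, |a i|) ≤ ‖∑ i, a i • x i‖ ∧ ‖∑ i, a i • x i‖ ≤ B * ⨆ i, |a i|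

/-- `X` is `C`-asymptotic-`c₀` (winning strategy for the subspace player). -/
def IsAsymptoticC0With (C : ℝ) (X : Type*) [NormedAddCommGroup X] [NormedSpace ℝ X] : Prop :=
  ∀ k : ℕ, ∀ ε : ℝ, 0 < ε →
    ∃ σ : (Σ i : Fin k, (Fin i.1 → X)) → Submodule ℝ X,
      (∀ p, FinCodimClosed (σ p)) ∧
      ∀ x : Fin k → X,
        (∀ i : Fin k, ‖x i‖ = 1 ∧ x i ∈ σ ⟨i, fun j => x ⟨j.1, j.2.trans i.2⟩⟩) →
        EquivLinftyBasis (C + ε) x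

/-- `X` is asymptotic-`c₀` if it is `C`-asymptotic-`c₀` for some `C ≥ 1`. -/
def AsymptoticC0 (X : Type*) [NormedAddCommGroup X] [NormedSpace ℝ X] : Prop :=
  ∃ C : ℝ, 1 ≤ C ∧ IsAsymptoticC0With C X


/-- `g` is a uniform embedding: `ω_g(t) → 0` as `t → 0` and `ρ_g(t) > 0` for every `t > 0`. -/
def UniformEmbeddingMap {α β : Type*} [PseudoMetricSpace α] [PseudoMetricSpace β]
    (g : α → β) : Prop :=
  (∀ ε : ℝ, 0 < ε → ∃ δ : ℝ, 0 < δ ∧ ∀ x y : α, dist x y ≤ δ → dist (g x) (g y) ≤ ε) ∧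
  (∀ t : ℝ, 0 < t → ∃ c : ℝ, 0 < c ∧ ∀ x y : α, t ≤ dist x y → c ≤ dist (g x) (g y))

section Codimension

variable {X : Type*} [NormedAddCommGroup X] [NormedSpace ℝ X]

lemma finCodimClosed_top : FinCodimClosed (⊤ : Submodule ℝ X) :=
  ⟨isClosed_univ, Submodule.CoFG.top⟩

lemma finCodimClosed_ker (f : StrongDual ℝ X) : FinCodimClosed (LinearMap.ker f.toLinearMap) :=
  ⟨f.isClosed_ker, Submodule.CoFG.ker _⟩

lemma FinCodimClosed.inf {V W : Submodule ℝ X} (hV : FinCodimClosed V) (hW : FinCodimClosed W) :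
    FinCodimClosed (V ⊓ W) :=
  ⟨hV.1.inter hW.1, Submodule.CoFG.inf hV.2 hW.2⟩

/-- A property of closed finite-codimensional subspaces that is inherited by smaller subspaces and
satisfied for each point of a finite set is satisfied for all of them simultaneously. -/
lemma exists_finCodimClosed_forall_mem {ι : Type*} {s : Set ι} (hs : s.Finite)
    {p : ι → X → Prop}
    (h : ∀ i ∈ s, ∃ V : Submodule ℝ X, FinCodimClosed V ∧ ∀ u ∈ V, p i u) :
    ∃ V : Submodule ℝ X, FinCodimClosed V ∧ ∀ i ∈ s, ∀ u ∈ V, p i u := by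
  induction s, hs using Set.Finite.induction_on with
  | empty => exact ⟨⊤, finCodimClosed_top, by simp⟩
  | @insert a s _ _ ih =>
    obtain ⟨V, hV, hV'⟩ := ih fun i hi => h i (Set.mem_insert_of_mem _ hi)
    obtain ⟨W, hW, hW'⟩ := h a (Set.mem_insert _ _)
    refine ⟨V ⊓ W, hV.inf hW, ?_⟩
    rintro i (rfl | hi) u hu
    · exact hW' u hu.2
    · exact hV' i hi u hu.1

/-- A closed finite-codimensional subspace almost orthogonal to a finite-dimensional one. -/
lemma exists_finCodimClosed_norm_le (E : Submodule ℝ X) [FiniteDimensional ℝ E] {η : ℝ}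
    (hη : 0 < η) :
    ∃ V : Submodule ℝ X, FinCodimClosed V ∧ ∀ e ∈ E, ∀ w ∈ V, (1 - η) * ‖e‖ ≤ ‖e + w‖ := by
  choose φ hφ hφe using fun x : X => exists_dual_vector'' ℝ x
  obtain ⟨t, hsub, ht, hcov⟩ :=
    (isCompact_sphere (0 : E) 1).finite_cover_balls hη
  obtain ⟨V, hV, hker⟩ := exists_finCodimClosed_forall_mem (X := X) ht
    (p := fun i u => φ i u = 0)
    fun i _ => ⟨_, finCodimClosed_ker (φ i), fun u hu => hu⟩
  refine ⟨V, hV, fun e he w hw => ?_⟩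
  have key : ∀ e ∈ E, ‖e‖ = 1 → ∀ w ∈ V, 1 - η ≤ ‖e + w‖ := by
    intro e he h1 w hw
    have : (⟨e, he⟩ : E) ∈ Metric.sphere (0 : E) 1 := by simpa using h1
    obtain ⟨i, hi, hei⟩ := Set.mem_iUnion₂.1 (hcov this)
    have hd : ‖e - i‖ < η := by simpa [dist_eq_norm] using hei
    have hi1 : ‖(i : X)‖ = 1 := by simpa using hsub hi
    have h2 : φ i (e + w) = 1 + φ i (e - i) := by
      have h0 : φ i w = 0 := hker i hi w hw
      rw [map_add, h0, map_sub, hφe, hi1]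
      simp
    have h3 := (φ i).le_of_opNorm_le (hφ i) (e - i)
    have h4 := (φ i).le_of_opNorm_le (hφ i) (e + w)
    rw [one_mul, Real.norm_eq_abs] at h3 h4
    have := (abs_le.1 h3).1
    have := (abs_le.1 h4).2
    linarith
  rcases eq_or_ne e 0 with rfl | h0
  · simp
  have hpos : 0 < ‖e‖ := norm_pos_iff.2 h0
  have := key (‖e‖⁻¹ • e) (E.smul_mem _ he) (by simp [norm_smul, hpos.ne']) (‖e‖⁻¹ • w)
    (V.smul_mem _ hw)
  rw [← smul_add, norm_smul, norm_inv, norm_norm, inv_mul_eq_div, le_div_iff₀ hpos] at this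
  exact this

end Codimension

section IteratedUltrafilters

/-- The iterated product of a list of ultrafilters, as an ultrafilter on lists. -/
def iterUltrafilter {α : Type*} : List (Ultrafilter α) → Ultrafilter (List α)
  | [] => pure []
  | U :: Us => U.bind fun a => (iterUltrafilter Us).map (List.cons a)

variable {α : Type*}

@[simp] lemma eventually_iterUltrafilter_nil {p : List α → Prop} :
    (∀ᶠ l in (iterUltrafilter ([] : List (Ultrafilter α)) : Filter (List α)), p l) ↔ p [] := Iff.rfl

@[simp] lemma eventually_iterUltrafilter_cons {U : Ultrafilter α} {Us : List (Ultrafilter α)}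
    {p : List α → Prop} :
    (∀ᶠ l in (iterUltrafilter (U :: Us) : Filter (List α)), p l) ↔
      ∀ᶠ a in (U : Filter α), ∀ᶠ l in (iterUltrafilter Us : Filter (List α)), p (a :: l) :=
  Iff.rfl

lemma eventually_iterUltrafilter_length (Us : List (Ultrafilter α)) :
    ∀ᶠ l in (iterUltrafilter Us : Filter (List α)), l.length = Us.length := by
  induction Us with
  | nil => simp
  | cons U Us ih =>
    rw [eventually_iterUltrafilter_cons]
    exact .of_forall fun a => ih.mono fun l hl => by simp [hl]

lemma eventually_iterUltrafilter_forall_mem {Us : List (Ultrafilter α)} {p : α → Prop}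
    (h : ∀ U ∈ Us, ∀ᶠ a in (U : Filter α), p a) :
    ∀ᶠ l in (iterUltrafilter Us : Filter (List α)), ∀ a ∈ l, p a := by
  induction Us with
  | nil => simp
  | cons U Us ih =>
    rw [eventually_iterUltrafilter_cons]
    refine (h U (by simp)).mono fun a ha => ?_
    refine (ih fun V hV => h V (by simp [hV])).mono fun l hl => ?_
    simpa using ⟨ha, hl⟩

end IteratedUltrafilters

section WeakLimits

open Topology

/-- Bounded functionals converge weak-star along any ultrafilter. -/
lemma exists_weakStar_limit {E ι : Type*} [NormedAddCommGroup E] [NormedSpace ℝ E]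
    (𝒰 : Ultrafilter ι) (T : ι → StrongDual ℝ E) {M : ℝ}
    (h : ∀ᶠ i in (𝒰 : Filter ι), ‖T i‖ ≤ M) :
    ∃ T₀ : StrongDual ℝ E, ‖T₀‖ ≤ M ∧ ∀ e, Tendsto (fun i => T i e) 𝒰 (𝓝 (T₀ e)) := by
  have hc := WeakDual.isCompact_closedBall (𝕜 := ℝ) (0 : StrongDual ℝ E) M
  obtain ⟨T₀, hT₀, hle⟩ := hc.ultrafilter_le_nhds (𝒰.map fun i => StrongDual.toWeakDual (T i)) (by
    rw [le_principal_iff]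
    exact h.mono fun i hi => by simpa using hi)
  refine ⟨WeakDual.toStrongDual T₀, by simpa using hT₀, fun e => ?_⟩
  have h1 : Tendsto (fun i => StrongDual.toWeakDual (T i)) 𝒰 (𝓝 T₀) := hle
  exact ((WeakDual.eval_continuous e).tendsto T₀).comp h1

variable {Y : Type*} [NormedAddCommGroup Y] [NormedSpace ℝ Y]

/-- Bounded families in a reflexive space converge weakly along any ultrafilter. -/
lemma IsReflexiveSpace.exists_weak_limit (hY : IsReflexiveSpace Y) {ι : Type*}
    (𝒰 : Ultrafilter ι) (h : ι → Y) {M : ℝ} (hM : ∀ᶠ i in (𝒰 : Filter ι), ‖h i‖ ≤ M) :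
    ∃ y : Y, ∀ f : StrongDual ℝ Y, Tendsto (fun i => f (h i)) 𝒰 (𝓝 (f y)) := by
  obtain ⟨T, -, hT⟩ := exists_weakStar_limit 𝒰
    (fun i => NormedSpace.inclusionInDoubleDual ℝ Y (h i))
    (hM.mono fun i hi => (NormedSpace.double_dual_bound ℝ Y _).trans hi)
  obtain ⟨y, rfl⟩ := hY T
  exact ⟨y, hT⟩

lemma norm_le_of_tendsto_weak {ι : Type*} {l : Filter ι} [l.NeBot] {h : ι → Y} {y : Y} {L : ℝ}
    (hL : 0 ≤ L) (hlim : ∀ f : StrongDual ℝ Y, Tendsto (fun i => f (h i)) l (𝓝 (f y)))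
    (hh : ∀ᶠ i in l, ‖h i‖ ≤ L) : ‖y‖ ≤ L :=
  NormedSpace.norm_le_dual_bound ℝ y hL fun f =>
    le_of_tendsto (hlim f).norm (hh.mono fun i hi => by
      rw [mul_comm]; exact f.le_opNorm_of_le hi)

/-- A weakly null family is asymptotically close to any closed finite-codimensional subspace. -/
lemma eventually_exists_mem_norm_sub_lt {ι : Type*} {l : Filter ι} {d : ι → Y}
    (hd : ∀ f : StrongDual ℝ Y, Tendsto (fun i => f (d i)) l (𝓝 0))
    {V : Submodule ℝ Y} (hV : FinCodimClosed V) {δ : ℝ} (hδ : 0 < δ) :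
    ∀ᶠ i in l, ∃ u ∈ V, ‖u - d i‖ < δ := by
  have : FiniteDimensional ℝ (Y ⧸ V) := hV.2
  have : IsClosed (V : Set Y) := hV.1
  let b := Module.finBasis ℝ (Y ⧸ V)
  have hq : Tendsto (fun i => (V.mkQ (d i))) l (𝓝 0) := by
    have h1 : ∀ i, V.mkQ (d i) = ∑ j, b.coord j (V.mkQ (d i)) • b j := fun i =>
      (b.sum_repr (V.mkQ (d i))).symm
    rw [funext h1, show (0 : Y ⧸ V) = ∑ j, (0 : ℝ) • b j by simp]
    refine tendsto_finsetSum _ fun j _ => Tendsto.smul_const ?_ _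
    exact hd ((LinearMap.toContinuousLinearMap (b.coord j)).comp V.mkQL)
  have := (hq.norm.eventually_lt_const (u := δ) (by simpa using hδ))
  refine this.mono fun i hi => ?_
  obtain ⟨m, hm, hm'⟩ := Submodule.Quotient.norm_mk_lt (V.mkQ (d i)) (sub_pos.2 hi)
  refine ⟨d i - m, ?_, by simpa using hm'⟩
  rw [← Submodule.Quotient.mk_eq_zero, Submodule.Quotient.mk_sub, hm]
  simp

end WeakLimits

section Concentration

open Topology

/-- The subspace player, restricted to `n` further rounds starting from the partial sum `v`, can
keep the final sum of vectors from the unit ball within the ball of radius `C`. -/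
def SumBoundGame {X : Type*} [NormedAddCommGroup X] [NormedSpace ℝ X] (C : ℝ) : ℕ → X → Prop
  | 0, v => ‖v‖ ≤ C
  | n + 1, v => ∃ V : Submodule ℝ X, FinCodimClosed V ∧
      ∀ u ∈ V, ‖u‖ ≤ 1 → SumBoundGame C n (v + u)

/-- Changing one entry of a list moves the value of `h` by at most `L`. -/
def HammingLipschitz {α Y : Type*} [NormedAddCommGroup Y] (L : ℝ) (h : List α → Y) : Prop :=
  ∀ l₁ a b l₂, ‖h (l₁ ++ a :: l₂) - h (l₁ ++ b :: l₂)‖ ≤ L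

variable {α Y : Type*} [NormedAddCommGroup Y] {L : ℝ} {h : List α → Y}

lemma HammingLipschitz.cons (hh : HammingLipschitz L h) (a : α) :
    HammingLipschitz L fun l => h (a :: l) :=
  fun l₁ => hh (a :: l₁)

lemma HammingLipschitz.norm_sub_le (hh : HammingLipschitz L h) {l l' : List α}
    (hl : l.length = l'.length) : ‖h l - h l'‖ ≤ l.length * L := by
  induction l generalizing l' h with
  | nil => simp [List.length_eq_zero_iff.1 hl.symm]
  | cons a l ih =>
    obtain _ | ⟨b, l'⟩ := l'
    · simp at hl
    · have h1 := hh [] a b l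
      have h2 := ih (hh.cons b) (by simpa using hl)
      have h3 := norm_sub_le_norm_sub_add_norm_sub (h (a :: l)) (h (b :: l)) (h (b :: l'))
      simp only [List.nil_append, List.length_cons, Nat.cast_add, Nat.cast_one] at *
      linarith

lemma HammingLipschitz.exists_eventually_norm_le (hh : HammingLipschitz L h)
    (Us : List (Ultrafilter α)) :
    ∃ M, ∀ᶠ l in (iterUltrafilter Us : Filter (List α)), ‖h l‖ ≤ M := by
  have hlen := eventually_iterUltrafilter_length Us
  obtain ⟨l₀, hl₀⟩ := hlen.exists
  refine ⟨‖h l₀‖ + Us.length * L, hlen.mono fun l hl => ?_⟩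
  have h1 := hh.norm_sub_le (hl.trans hl₀.symm)
  rw [hl] at h1
  have h2 := norm_le_norm_add_norm_sub' (h l) (h l₀)
  linarith

variable [NormedSpace ℝ Y]

/-- Iterated limits of Hamming-Lipschitz maps into a reflexive space concentrate around their weak
limit when the subspace player controls sums. -/
lemma HammingLipschitz.eventually_norm_le (hY : IsReflexiveSpace Y) {C δ : ℝ} (hδ : 0 < δ)
    (hL0 : 0 ≤ L) (hL : L ≤ 1) (Us : List (Ultrafilter α)) (hh : HammingLipschitz L h) {y : Y}
    (hy : ∀ f : StrongDual ℝ Y,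
      Tendsto (fun l => f (h l)) (iterUltrafilter Us) (𝓝 (f y)))
    {v : Y} (hv : SumBoundGame C Us.length v) :
    ∀ᶠ l in (iterUltrafilter Us : Filter (List α)), ‖v + (h l - y)‖ ≤ C + Us.length * δ := by
  induction Us generalizing h y v with
  | nil =>
    have h1 : h [] - y = 0 := by
      rw [sub_eq_zero]
      refine (SeparatingDual.eq_iff_forall_dual_eq (R := ℝ)).2 fun f => ?_
      exact tendsto_nhds_unique (tendsto_pure_nhds (fun l => f (h l)) []) (hy f)
    rw [eventually_iterUltrafilter_nil]
    simpa [h1] using (show ‖v‖ ≤ C from hv)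
  | cons U Us ih =>
    have hex : ∀ a, ∃ e : Y, ∀ f : StrongDual ℝ Y,
        Tendsto (fun l => f (h (a :: l))) (iterUltrafilter Us) (𝓝 (f e)) := fun a =>
      let ⟨M, hM⟩ := (hh.cons a).exists_eventually_norm_le Us
      hY.exists_weak_limit _ _ hM
    choose e he using hex
    have hey : ∀ f : StrongDual ℝ Y, Tendsto (fun a => f (e a)) U (𝓝 (f y)) := by
      intro f
      refine Metric.tendsto_nhds.2 fun ε hε => ?_
      have h1 := Metric.tendsto_nhds.1 (hy f) (ε / 2) (by positivity)
      rw [eventually_iterUltrafilter_cons] at h1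
      refine h1.mono fun a ha => ?_
      have := le_of_tendsto ((he a f).dist tendsto_const_nhds) (ha.mono fun l hl => hl.le)
      linarith
    have hee : ∀ a b, ‖e a - e b‖ ≤ L := fun a b =>
      norm_le_of_tendsto_weak (l := (iterUltrafilter Us : Filter (List α)))
        (h := fun l => h (a :: l) - h (b :: l)) hL0
        (fun f => by simpa using (he a f).sub (he b f)) (.of_forall fun l => hh [] a b l)
    have hed : ∀ a, ‖e a - y‖ ≤ 1 := fun a => hL.trans' <|
      norm_le_of_tendsto_weak (l := (U : Filter α)) (h := fun b => e a - e b) hL0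
        (fun f => by simpa using tendsto_const_nhds.sub (hey f)) (.of_forall fun b => hee a b)
    obtain ⟨V, hV, hgame⟩ := hv
    have hclose := eventually_exists_mem_norm_sub_lt (l := (U : Filter α)) (d := fun a => e a - y)
      (fun f => by simpa using (hey f).sub_const (f y)) hV (half_pos hδ)
    rw [eventually_iterUltrafilter_cons]
    refine hclose.mono fun a ⟨u, hu, hua⟩ => ?_
    have hu1 : ‖u‖ ≤ 1 + δ / 2 := by
      have := norm_le_norm_add_norm_sub' u (e a - y)
      linarith [hed a]
    have hpos : 0 < 1 + δ / 2 := by positivity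
    set w := (1 + δ / 2)⁻¹ • u with hw
    have hw1 : ‖w‖ ≤ 1 := by
      rw [hw, norm_smul, norm_inv, Real.norm_of_nonneg hpos.le, inv_mul_le_iff₀ hpos]
      linarith
    have huw : ‖u - w‖ ≤ δ / 2 := by
      have : u - w = (δ / 2) • w := by
        have h1 : u = (1 + δ / 2) • w := by rw [hw, smul_inv_smul₀ hpos.ne']
        nth_rewrite 1 [h1]
        rw [add_smul, one_smul, add_sub_cancel_left]
      rw [this, norm_smul, Real.norm_of_nonneg (by positivity)]
      nlinarith
    refine (ih (hh.cons a) (he a) (hgame w (V.smul_mem _ hu) hw1)).mono fun l hl => ?_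
    have hsplit : v + (h (a :: l) - y) =
        (v + w + (h (a :: l) - e a)) + ((u - w) - (u - (e a - y))) := by abel
    rw [hsplit]
    refine (norm_add_le _ _).trans ?_
    have := _root_.norm_sub_le (u - w) (u - (e a - y))
    simp only [List.length_cons, Nat.cast_add, Nat.cast_one] at *
    linarith

/-- A space in which the subspace player controls sums satisfies a concentration inequality for
Hamming-Lipschitz maps. -/
lemma HammingLipschitz.exists_concentration (hY : IsReflexiveSpace Y) {C : ℝ}
    (hC : ∀ k, SumBoundGame C k (0 : Y)) (hL : 0 < L) (hh : HammingLipschitz L h)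
    (Us : List (Ultrafilter α)) :
    ∃ y : Y, ∀ᶠ l in (iterUltrafilter Us : Filter (List α)), ‖h l - y‖ ≤ (C + 1) * L := by
  have hh' : HammingLipschitz 1 fun l => L⁻¹ • h l := fun l₁ a b l₂ => by
    rw [← smul_sub, norm_smul, norm_inv, Real.norm_of_nonneg hL.le, inv_mul_le_iff₀ hL, mul_one]
    exact hh l₁ a b l₂
  obtain ⟨M, hM⟩ := hh'.exists_eventually_norm_le Us
  obtain ⟨y, hy⟩ := hY.exists_weak_limit _ _ hM
  have hδ : (0 : ℝ) < 1 / (Us.length + 1) := by positivity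
  refine ⟨L • y, (HammingLipschitz.eventually_norm_le hY hδ zero_le_one le_rfl Us hh' hy
    (hC _)).mono fun l hl => ?_⟩
  have h1 : (Us.length : ℝ) * (1 / (Us.length + 1)) ≤ 1 := by
    rw [mul_one_div, div_le_one (by positivity)]
    linarith
  have h2 : h l - L • y = L • (L⁻¹ • h l - y) := by
    rw [smul_sub, smul_smul, mul_inv_cancel₀ hL.ne', one_smul]
  rw [zero_add] at hl
  rw [h2, norm_smul, Real.norm_of_nonneg hL.le, mul_comm]
  gcongr
  linarith

end Concentration

section Goldstine

open Topology

variable {X : Type*} [NormedAddCommGroup X] [NormedSpace ℝ X]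

/-- **Goldstine's theorem**, for finitely many functionals. -/
lemma exists_norm_le_one_abs_sub_lt {z : StrongDual ℝ (StrongDual ℝ X)} (hz : ‖z‖ ≤ 1)
    (S : Finset (StrongDual ℝ X)) {ε : ℝ} (hε : 0 < ε) :
    ∃ x : X, ‖x‖ ≤ 1 ∧ ∀ f ∈ S, |f x - z f| < ε := by
  classical
  let T : X →L[ℝ] (S → ℝ) := ContinuousLinearMap.pi fun f => (f : StrongDual ℝ X)
  have hconv : Convex ℝ (T '' Metric.closedBall 0 1) :=
    (convex_closedBall 0 1).is_linear_image T.toLinearMap.isLinear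
  have hmem : (fun f : S => z f) ∈ closure (T '' Metric.closedBall 0 1) := by
    by_contra hcon
    obtain ⟨g, u, hg, hu⟩ :=
      geometric_hahn_banach_closed_point hconv.closure isClosed_closure hcon
    have hexp : ∀ w : S → ℝ, g w = ∑ f, w f * g (Pi.single f 1) := fun w => by
      conv_lhs => rw [pi_eq_sum_univ' w]
      simp [map_sum, Pi.single]
    have hφx : ∀ x : X, ‖x‖ ≤ 1 → (g.comp T) x < u := fun x hx =>
      hg _ (subset_closure ⟨x, by simpa using hx, rfl⟩)
    have hu0 : 0 < u := by simpa using hφx 0 (by simp)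
    have hφ : ‖g.comp T‖ ≤ u := ContinuousLinearMap.opNorm_le_of_unit_norm hu0.le fun x hx => by
      rw [Real.norm_eq_abs, abs_le]
      have h1 := hφx x hx.le
      have h2 := hφx (-x) (by simpa using hx.le)
      rw [map_neg] at h2
      constructor <;> linarith
    have hzφ : z (g.comp T) = g fun f : S => z f := by
      have : g.comp T = ∑ f : S, g (Pi.single f 1) • (f : StrongDual ℝ X) := by
        ext x
        rw [ContinuousLinearMap.comp_apply, hexp]
        simp [T, mul_comm]
      rw [this, map_sum, hexp]
      simp [mul_comm]
    have h3 := z.le_of_opNorm_le hz (g.comp T)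
    rw [Real.norm_eq_abs] at h3
    have := le_abs_self (z (g.comp T))
    linarith
  obtain ⟨-, ⟨x, hx, rfl⟩, hd⟩ := Metric.mem_closure_iff.1 hmem ε hε
  refine ⟨x, by simpa using hx, fun f hf => ?_⟩
  have := (dist_pi_lt_iff hε).1 hd ⟨f, hf⟩
  rwa [dist_comm, Real.dist_eq] at this

/-- **Goldstine's theorem**, with an ultrafilter on the unit ball. -/
lemma exists_ultrafilter_tendsto_bidual {z : StrongDual ℝ (StrongDual ℝ X)} (hz : ‖z‖ ≤ 1) :
    ∃ U : Ultrafilter X, (∀ᶠ x in (U : Filter X), ‖x‖ ≤ 1) ∧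
      ∀ f : StrongDual ℝ X, Tendsto (fun x => f x) U (𝓝 (z f)) := by
  classical
  let A : Finset (StrongDual ℝ X) × {ε : ℝ // 0 < ε} → Filter X := fun p =>
    𝓟 {x | ‖x‖ ≤ 1 ∧ ∀ f ∈ p.1, |f x - z f| < p.2}
  have hdir : Directed (· ≥ ·) A := by
    rintro ⟨S, ε⟩ ⟨S', ε'⟩
    refine ⟨⟨S ∪ S', ⟨min ε.1 ε'.1, lt_min ε.2 ε'.2⟩⟩, ?_, ?_⟩ <;>
    · refine principal_mono.2 fun x hx => ⟨hx.1, fun f hf => ?_⟩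
      exact (hx.2 f (Finset.mem_union.2 (by tauto))).trans_le (by simp)
  have : NeBot (iInf A) := iInf_neBot_of_directed hdir
    fun (p : Finset (StrongDual ℝ X) × {ε : ℝ // 0 < ε}) =>
      principal_neBot_iff.2 (exists_norm_le_one_abs_sub_lt hz p.1 p.2.2)
  have hle : ∀ p : Finset (StrongDual ℝ X) × {ε : ℝ // 0 < ε},
      ∀ᶠ x in (Ultrafilter.of (iInf A) : Filter X), ‖x‖ ≤ 1 ∧ ∀ f ∈ p.1, |f x - z f| < p.2 := fun p =>
    (Ultrafilter.of_le _).trans (iInf_le A p) (mem_principal_self _)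
  refine ⟨Ultrafilter.of (iInf A), (hle ⟨∅, 1, one_pos⟩).mono fun x hx => hx.1, fun f => ?_⟩
  refine Metric.tendsto_nhds.2 fun ε hε => (hle ⟨{f}, ε, hε⟩).mono fun x hx => ?_
  exact hx.2 f (by simp)

/-- **Helly's theorem**: a functional at distance more than `θ` from the span of finitely many
functionals exceeds `θ` at a point of the unit ball where these vanish. -/
lemma exists_forall_eq_zero_lt {ι : Type*} [Finite ι] (J : ι → StrongDual ℝ X)
    {z : StrongDual ℝ X} {θ : ℝ} (hz : ∀ c : ι →₀ ℝ, θ < ‖z - c.sum fun i r => r • J i‖) :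
    ∃ x : X, ‖x‖ ≤ 1 ∧ (∀ i, J i x = 0) ∧ θ < z x := by
  let p : Submodule ℝ X := ⨅ i, LinearMap.ker (J i).toLinearMap
  let q : StrongDual ℝ p := z.comp p.subtypeL
  obtain ⟨z', hz', hnorm⟩ := exists_extension_norm_eq p q
  have hspan : (z - z').toLinearMap ∈
      Submodule.span ℝ (Set.range fun i => (J i).toLinearMap) := by
    refine mem_span_of_iInf_ker_le_ker fun x hx => ?_
    have h : z' x = z x := hz' ⟨x, hx⟩
    simp [h]
  obtain ⟨c, hc⟩ := Finsupp.mem_span_range_iff_exists_finsupp.1 hspan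
  have hc' : (c.sum fun i r => r • J i) = z - z' := by
    ext x
    have := congrArg (fun T => T x) hc
    simpa [Finsupp.sum] using this
  have h1 : θ < ‖q‖ := by
    simpa only [hc', sub_sub_cancel, hnorm] using hz c
  obtain ⟨⟨x, hx⟩, hx1, hθ⟩ := q.exists_lt_apply_of_lt_opNorm h1
  have hker : ∀ i, J i x = 0 := (Submodule.mem_iInf _).1 hx
  have hx1' : ‖x‖ ≤ 1 := hx1.le
  rcases lt_abs.1 hθ with h | h
  · exact ⟨x, hx1', hker, h⟩
  · exact ⟨-x, by simpa using hx1', fun i => by simp [hker i], by rw [map_neg]; exact h⟩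

/-- A point of the unit ball at positive distance from a proper closed subspace. -/
lemma exists_norm_le_one_forall_lt_norm_sub {F : Submodule ℝ X} (hF : IsClosed (F : Set X))
    {x₀ : X} (hx₀ : x₀ ∉ F) :
    ∃ z : X, ‖z‖ ≤ 1 ∧ ∃ θ : ℝ, 0 < θ ∧ ∀ y ∈ F, θ < ‖z - y‖ := by
  obtain ⟨x, hxF, hx⟩ := riesz_lemma hF ⟨x₀, hx₀⟩ one_half_lt_one
  have hpos : 0 < ‖x‖ := norm_pos_iff.2 fun h => hxF (h ▸ F.zero_mem)
  refine ⟨‖x‖⁻¹ • x, by simp [norm_smul, hpos.ne'], 1 / 3, by norm_num, fun y hy => ?_⟩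
  have h1 : ‖x‖⁻¹ • x - y = ‖x‖⁻¹ • (x - ‖x‖ • y) := by
    rw [smul_sub, inv_smul_smul₀ hpos.ne']
  rw [h1, norm_smul, norm_inv, norm_norm, inv_mul_eq_div, lt_div_iff₀ hpos]
  have := hx _ (F.smul_mem ‖x‖ hy)
  linarith

/-- In a nonreflexive space, some ultrafilter on the unit ball stays separated from all
finite-dimensional subspaces. -/
lemma exists_ultrafilter_of_not_isReflexiveSpace [CompleteSpace X] (hX : ¬ IsReflexiveSpace X) :
    ∃ θ : ℝ, 0 < θ ∧ ∃ U : Ultrafilter X, (∀ᶠ x in (U : Filter X), ‖x‖ ≤ 1) ∧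
      ∀ l : List X, ∃ f : StrongDual ℝ X, ‖f‖ ≤ 1 ∧ (∀ x ∈ l, f x = 0) ∧
        ∀ᶠ x in (U : Filter X), θ < f x := by
  obtain ⟨z₀, hz₀⟩ := not_forall.1 hX
  have hiso : Isometry (NormedSpace.inclusionInDoubleDual ℝ X) :=
    (NormedSpace.inclusionInDoubleDualLi (E := X) ℝ).isometry
  let F : Submodule ℝ (StrongDual ℝ (StrongDual ℝ X)) :=
    LinearMap.range (NormedSpace.inclusionInDoubleDual ℝ X).toLinearMap
  have hF : IsClosed (F : Set (StrongDual ℝ (StrongDual ℝ X))) :=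
    hiso.isClosedEmbedding.isClosed_range
  obtain ⟨z, hz, θ, hθ, hfar⟩ := exists_norm_le_one_forall_lt_norm_sub
    (X := StrongDual ℝ (StrongDual ℝ X)) (F := F) hF (x₀ := z₀) hz₀
  obtain ⟨U, hU, hlim⟩ := exists_ultrafilter_tendsto_bidual hz
  refine ⟨θ, hθ, U, hU, fun l => ?_⟩
  obtain ⟨f, hf, hker, hlt⟩ := exists_forall_eq_zero_lt
    (fun i : Fin l.length => NormedSpace.inclusionInDoubleDual ℝ X l[i])
    (z := z) (θ := θ) fun c => by
      refine hfar _ ⟨c.sum fun i r => r • l[i], ?_⟩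
      simp [map_finsuppSum]
  refine ⟨f, hf, fun x hx => ?_, (hlim f).eventually_const_lt hlt⟩
  obtain ⟨i, hi, rfl⟩ := List.getElem_of_mem hx
  exact hker ⟨i, hi⟩

end Goldstine

section Radial

variable {X : Type*} [NormedAddCommGroup X] [NormedSpace ℝ X]

/-- The radial retraction onto the closed unit ball. -/
noncomputable def radialRetraction (x : X) : X := (max 1 ‖x‖)⁻¹ • x

lemma norm_radialRetraction (x : X) : ‖radialRetraction x‖ = ‖x‖ / max 1 ‖x‖ := by
  have : 0 < max 1 ‖x‖ := lt_max_of_lt_left one_pos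
  rw [radialRetraction, norm_smul, norm_inv, Real.norm_of_nonneg this.le, inv_mul_eq_div]

lemma norm_radialRetraction_le_one (x : X) : ‖radialRetraction x‖ ≤ 1 := by
  rw [norm_radialRetraction]
  exact div_le_one_of_le₀ (le_max_right _ _) (by positivity)

lemma radialRetraction_of_norm_le_one {x : X} (hx : ‖x‖ ≤ 1) : radialRetraction x = x := by
  rw [radialRetraction, max_eq_left hx, inv_one, one_smul]

lemma norm_radialRetraction_sub_le (x y : X) :
    ‖radialRetraction x - radialRetraction y‖ ≤ 2 * ‖x - y‖ := by
  unfold radialRetraction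
  set a := max 1 ‖x‖
  set b := max 1 ‖y‖
  have ha : 1 ≤ a := le_max_left _ _
  have hb : 1 ≤ b := le_max_left _ _
  have hyb : ‖y‖ ≤ b := le_max_right _ _
  have hba : |b - a| ≤ ‖x - y‖ := by
    have h1 : |b - a| ≤ max |1 - 1| |‖y‖ - ‖x‖| := abs_max_sub_max_le_max _ _ _ _
    have h2 := abs_norm_sub_norm_le y x
    rw [norm_sub_rev] at h2
    simpa using h1.trans (max_le (by simp) h2)
  have hsplit : a⁻¹ • x - b⁻¹ • y = a⁻¹ • (x - y) + (a⁻¹ - b⁻¹) • y := by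
    rw [smul_sub, sub_smul]; abel
  have h1 : ‖a⁻¹ • (x - y)‖ ≤ ‖x - y‖ := by
    rw [norm_smul, norm_inv, Real.norm_of_nonneg (by positivity)]
    exact mul_le_of_le_one_left (norm_nonneg _) (inv_le_one_of_one_le₀ ha)
  have h2 : ‖(a⁻¹ - b⁻¹) • y‖ ≤ ‖x - y‖ := by
    rw [norm_smul, inv_sub_inv (by positivity) (by positivity), norm_div, Real.norm_eq_abs,
      Real.norm_of_nonneg (by positivity), div_mul_eq_mul_div, div_le_iff₀ (by positivity)]
    have := norm_nonneg (x - y)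
    gcongr
    nlinarith
  rw [hsplit]
  linarith [norm_add_le (a⁻¹ • (x - y)) ((a⁻¹ - b⁻¹) • y)]

end Radial

section ConcentrationInBall

open Topology

/-- Hamming-Lipschitz maps with small constant, retracted to the unit ball, concentrate along
iterated ultrafilters. -/
def ConcentratesOn (α X : Type*) [NormedAddCommGroup X] [NormedSpace ℝ X] (t δ : ℝ) : Prop :=
  ∀ (Us : List (Ultrafilter α)) (z : List α → X), HammingLipschitz δ z →
    ∀ᶠ l in (iterUltrafilter Us : Filter (List α)),
      ∀ᶠ l' in (iterUltrafilter Us : Filter (List α)),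
        ‖radialRetraction (z l) - radialRetraction (z l')‖ < t

variable {X : Type*} [NormedAddCommGroup X] [NormedSpace ℝ X]

lemma concentratesOn_of_moduli {Y : Type*} [NormedAddCommGroup Y] [NormedSpace ℝ Y]
    (hY : IsReflexiveSpace Y) {C : ℝ} (hC0 : 0 ≤ C) (hC : ∀ k, SumBoundGame C k (0 : Y))
    {g : Metric.closedBall (0 : X) 1 → Y} {t c δ : ℝ} (hc : 0 < c)
    (hgc : ∀ x y, t ≤ dist x y → c ≤ dist (g x) (g y))
    (hgδ : ∀ x y, dist x y ≤ δ → dist (g x) (g y) ≤ c / (4 * (C + 1))) (α : Type*) :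
    ConcentratesOn α X t (δ / 2) := by
  intro Us z hz
  let r : X → Metric.closedBall (0 : X) 1 := fun x =>
    ⟨radialRetraction x, by simpa using norm_radialRetraction_le_one x⟩
  have hr : ∀ x y, dist (r x) (r y) = ‖radialRetraction x - radialRetraction y‖ := fun x y => by
    rw [Subtype.dist_eq, dist_eq_norm]
  have hL : 0 < c / (4 * (C + 1)) := by positivity
  have hG : HammingLipschitz (c / (4 * (C + 1))) fun l => g (r (z l)) := fun l₁ a b l₂ => by
    rw [← dist_eq_norm]
    refine hgδ _ _ ?_
    rw [hr]
    have := norm_radialRetraction_sub_le (z (l₁ ++ a :: l₂)) (z (l₁ ++ b :: l₂))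
    have := hz l₁ a b l₂
    linarith
  obtain ⟨y, hy⟩ := hG.exists_concentration hY hC hL Us
  have hquarter : (C + 1) * (c / (4 * (C + 1))) = c / 4 := by field_simp
  rw [hquarter] at hy
  refine hy.mono fun l hl => hy.mono fun l' hl' => ?_
  by_contra! hcon
  rw [← hr] at hcon
  have h1 := hgc _ _ hcon
  have h2 := dist_triangle_right (g (r (z l))) (g (r (z l'))) y
  rw [dist_eq_norm _ y, dist_eq_norm _ y] at h2
  linarith

lemma UniformEmbeddingMap.exists_concentratesOn {Y : Type*} [NormedAddCommGroup Y]
    [NormedSpace ℝ Y] (hY : IsReflexiveSpace Y) {C : ℝ} (hC0 : 0 ≤ C)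
    (hC : ∀ k, SumBoundGame C k (0 : Y)) {g : Metric.closedBall (0 : X) 1 → Y}
    (hg : UniformEmbeddingMap g) {t : ℝ} (ht : 0 < t) (α β : Type*) :
    ∃ δ : ℝ, 0 < δ ∧ ConcentratesOn α X t δ ∧ ConcentratesOn β X t δ := by
  obtain ⟨c, hc, hgc⟩ := hg.2 t ht
  obtain ⟨δ, hδ, hgδ⟩ := hg.1 (c / (4 * (C + 1))) (by positivity)
  exact ⟨δ / 2, half_pos hδ, concentratesOn_of_moduli hY hC0 hC hc hgc hgδ α,
    concentratesOn_of_moduli hY hC0 hC hc hgc hgδ β⟩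

lemma hammingLipschitz_smul_sum {α : Type*} {z : α → X} {M c : ℝ} (hc : 0 ≤ c)
    (hz : ∀ a, ‖z a‖ ≤ M) : HammingLipschitz (c * (2 * M)) fun l => c • (l.map z).sum := by
  intro l₁ a b l₂
  have h1 : c • ((l₁ ++ a :: l₂).map z).sum - c • ((l₁ ++ b :: l₂).map z).sum =
      c • (z a - z b) := by
    simp only [← smul_sub, List.map_append, List.sum_append, List.map_cons, List.sum_cons]
    congr 1
    abel
  rw [h1, norm_smul, Real.norm_of_nonneg hc]
  gcongr
  linarith [norm_sub_le (z a) (z b), hz a, hz b]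

lemma norm_list_sum_le_length_mul {E : Type*} [SeminormedAddCommGroup E] {l : List E} {M : ℝ}
    (h : ∀ x ∈ l, ‖x‖ ≤ M) :
    ‖l.sum‖ ≤ l.length * M := by
  induction l with
  | nil => simp
  | cons a l ih =>
    have h1 := h a (by simp)
    have h2 := ih fun x hx => h x (by simp [hx])
    simp only [List.sum_cons, List.length_cons, Nat.cast_add, Nat.cast_one]
    linarith [norm_add_le a l.sum]

lemma apply_list_sum_eq_zero {f : StrongDual ℝ X} {l : List X} (h : ∀ x ∈ l, f x = 0) :
    f l.sum = 0 := by
  rw [map_list_sum]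
  refine List.sum_eq_zero fun r hr => ?_
  obtain ⟨x, hx, rfl⟩ := List.mem_map.1 hr
  exact h x hx

/-- A space whose unit ball concentrates Hamming-Lipschitz maps is reflexive. -/
lemma isReflexiveSpace_of_concentratesOn [CompleteSpace X]
    (h : ∀ t : ℝ, 0 < t → ∃ δ : ℝ, 0 < δ ∧ ConcentratesOn X X t δ) : IsReflexiveSpace X := by
  by_contra hX
  obtain ⟨θ, hθ, U, hU, hsep⟩ := exists_ultrafilter_of_not_isReflexiveSpace hX
  obtain ⟨δ, hδ, hconc⟩ := h θ hθ
  obtain ⟨k, hk⟩ := exists_nat_gt (2 / δ)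
  have hk0 : (0 : ℝ) < k := lt_trans (by positivity) hk
  let z : List X → X := fun l => (k : ℝ)⁻¹ • (l.map radialRetraction).sum
  have hz : HammingLipschitz δ z := fun l₁ a b l₂ => by
    refine (hammingLipschitz_smul_sum (inv_nonneg.2 hk0.le) norm_radialRetraction_le_one
      l₁ a b l₂).trans ?_
    rw [inv_mul_le_iff₀ hk0]
    linarith [(div_lt_iff₀ hδ).1 hk]
  let Us := List.replicate k U
  have hlen : ∀ᶠ l in (iterUltrafilter Us : Filter (List X)), l.length = k := by
    simpa [Us] using eventually_iterUltrafilter_length Us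
  have hball : ∀ᶠ l in (iterUltrafilter Us : Filter (List X)), ∀ x ∈ l, ‖x‖ ≤ 1 :=
    eventually_iterUltrafilter_forall_mem fun V hV => by rwa [List.eq_of_mem_replicate hV]
  have hmap : ∀ l : List X, (∀ x ∈ l, ‖x‖ ≤ 1) → l.map radialRetraction = l := fun l hl => by
    rw [List.map_congr_left fun x hx => radialRetraction_of_norm_le_one (hl x hx), List.map_id']
  have hz1 : ∀ l : List X, l.length = k → (∀ x ∈ l, ‖x‖ ≤ 1) →
      z l = (k : ℝ)⁻¹ • l.sum ∧ radialRetraction (z l) = z l := fun l hl hl1 => by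
    have h1 : z l = (k : ℝ)⁻¹ • l.sum := by simp only [z, hmap l hl1]
    refine ⟨h1, radialRetraction_of_norm_le_one ?_⟩
    have := norm_list_sum_le_length_mul hl1
    rw [h1, norm_smul, norm_inv, Real.norm_of_nonneg hk0.le, inv_mul_le_iff₀ hk0]
    rwa [hl] at this
  obtain ⟨l, ⟨hl, hl1⟩, hll⟩ := ((hlen.and hball).and (hconc Us z hz)).exists
  obtain ⟨f, hf, hker, hfθ⟩ := hsep l
  have hfθ' : ∀ᶠ l' in (iterUltrafilter Us : Filter (List X)), ∀ x ∈ l', θ < f x :=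
    eventually_iterUltrafilter_forall_mem fun V hV => by rwa [List.eq_of_mem_replicate hV]
  obtain ⟨l', ⟨⟨hl', hl1'⟩, hfl'⟩, hlt⟩ := (((hlen.and hball).and hfθ').and hll).exists
  obtain ⟨h1, h2⟩ := hz1 l hl hl1
  obtain ⟨h1', h2'⟩ := hz1 l' hl' hl1'
  have hsum : f l.sum = 0 := apply_list_sum_eq_zero hker
  have hsum' : k * θ ≤ f l'.sum := by
    rw [map_list_sum]
    have := List.card_nsmul_le_sum (l'.map f) θ fun r hr => by
      obtain ⟨x, hx, rfl⟩ := List.mem_map.1 hr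
      exact (hfl' x hx).le
    simpa [hl'] using this
  rw [h2, h2', norm_sub_rev] at hlt
  have h3 := (le_abs_self _).trans (f.le_of_opNorm_le hf (z l' - z l))
  rw [map_sub, h1, h1', map_smul, map_smul, hsum, smul_zero, sub_zero, smul_eq_mul, one_mul,
    ← h1, ← h1'] at h3
  have h4 : θ ≤ (k : ℝ)⁻¹ * f l'.sum := by
    rwa [le_inv_mul_iff₀ hk0]
  linarith

/-- Sums of bounded vectors along iterated ultrafilters are bounded, provided that two independent
sums are orthogonal with respect to given norming functionals. -/
lemma ConcentratesOn.eventually_norm_sum_le {α : Type*} {δ : ℝ} (hδ : 0 < δ)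
    (h : ConcentratesOn α X (1 / 2) δ) {φ : X → StrongDual ℝ X} (hφ : ∀ x, ‖φ x‖ ≤ 1)
    (hφx : ∀ x, φ x x = ‖x‖) {M : ℝ} (hM : 0 < M) {z : α → X} (hz : ∀ a, ‖z a‖ ≤ M)
    (Us : List (Ultrafilter α))
    (hsep : ∀ᶠ l in (iterUltrafilter Us : Filter (List α)),
      ∀ᶠ l' in (iterUltrafilter Us : Filter (List α)),
        φ (l.map z).sum (l'.map z).sum = 0) :
    ∀ᶠ l in (iterUltrafilter Us : Filter (List α)), ‖(l.map z).sum‖ ≤ 2 / δ * M := by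
  by_contra hcon
  rw [← Ultrafilter.eventually_not] at hcon
  simp only [not_le] at hcon
  have hlip := hammingLipschitz_smul_sum zero_le_one hz
  simp only [one_smul] at hlip
  obtain ⟨R, hR⟩ := hlip.exists_eventually_norm_le Us
  obtain ⟨r, -, hr⟩ := (isCompact_Icc (a := 0) (b := R)).ultrafilter_le_nhds
    ((iterUltrafilter Us).map fun l => ‖(l.map z).sum‖) (by
      rw [le_principal_iff]
      exact hR.mono fun l hl => ⟨norm_nonneg _, hl⟩)
  have hr : Tendsto (fun l : List α => ‖(l.map z).sum‖) (iterUltrafilter Us) (𝓝 r) := hr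
  have hKM : 2 / δ * M ≤ r := ge_of_tendsto hr (hcon.mono fun l hl => hl.le)
  have hr0 : 0 < r := lt_of_lt_of_le (by positivity) hKM
  have hscale : HammingLipschitz δ fun l => r⁻¹ • (l.map z).sum := fun l₁ a b l₂ => by
    refine (hammingLipschitz_smul_sum (inv_nonneg.2 hr0.le) hz l₁ a b l₂).trans ?_
    rw [inv_mul_le_iff₀ hr0]
    rw [div_mul_eq_mul_div, div_le_iff₀ hδ] at hKM
    exact hKM
  have hhalf := hr.eventually_const_lt (half_lt_self hr0)
  obtain ⟨l, ⟨hl, hl2⟩, hl3⟩ := ((hhalf.and hsep).and (h Us _ hscale)).exists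
  obtain ⟨l', hl2', hl3'⟩ := (hl2.and hl3).exists
  set s := (l.map z).sum
  have h1 := (le_abs_self _).trans ((φ s).le_of_opNorm_le (hφ s)
    (radialRetraction (r⁻¹ • s) - radialRetraction (r⁻¹ • (l'.map z).sum)))
  rw [map_sub, one_mul] at h1
  simp only [radialRetraction, map_smul, hl2', hφx, smul_eq_mul, mul_zero, sub_zero] at h1
  have h2 : (1 : ℝ) / 2 ≤ (max 1 ‖r⁻¹ • s‖)⁻¹ * (r⁻¹ * ‖s‖) := by
    have h3 : 1 / 2 ≤ r⁻¹ * ‖s‖ := by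
      rw [le_inv_mul_iff₀ hr0]
      linarith
    rw [norm_smul, norm_inv, Real.norm_of_nonneg hr0.le, inv_mul_eq_div _ (r⁻¹ * ‖s‖),
      le_div_iff₀ (lt_max_of_lt_left one_pos)]
    rcases max_cases 1 (r⁻¹ * ‖s‖) with h | h <;> linarith
  exact absurd hl3' (not_lt.2 (h2.trans h1))

end ConcentrationInBall

section WeaklyNull

open Topology

variable {X : Type*} [NormedAddCommGroup X] [NormedSpace ℝ X]

/-- An ultrafilter that concentrates on the unit ball and on the kernel of each functional. -/
structure IsWeaklyNullInBall (U : Ultrafilter X) : Prop where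
  norm_le : ∀ᶠ u in (U : Filter X), ‖u‖ ≤ 1
  eq_zero : ∀ f : StrongDual ℝ X, ∀ᶠ u in (U : Filter X), f u = 0

lemma isWeaklyNullInBall_pure_zero : IsWeaklyNullInBall (pure 0 : Ultrafilter X) where
  norm_le := by simp
  eq_zero f := by simp

/-- Sums along weakly null ultrafilters in the unit ball are bounded uniformly in the number of
terms. -/
lemma ConcentratesOn.eventually_norm_sum_le_of_isWeaklyNullInBall {δ : ℝ} (hδ : 0 < δ)
    (h : ConcentratesOn X X (1 / 2) δ) {Us : List (Ultrafilter X)}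
    (hUs : ∀ U ∈ Us, IsWeaklyNullInBall U) :
    ∀ᶠ l in (iterUltrafilter Us : Filter (List X)), ‖l.sum‖ ≤ 2 / δ := by
  choose φ hφ hφx using fun x : X => exists_dual_vector'' ℝ x
  have hball : ∀ᶠ l in (iterUltrafilter Us : Filter (List X)), l.map radialRetraction = l :=
    (eventually_iterUltrafilter_forall_mem fun U hU => (hUs U hU).norm_le).mono fun l hl => by
      rw [List.map_congr_left fun x hx => radialRetraction_of_norm_le_one (hl x hx),
        List.map_id']
  have hker : ∀ f : StrongDual ℝ X, ∀ᶠ l in (iterUltrafilter Us : Filter (List X)),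
      f l.sum = 0 := fun f =>
    (eventually_iterUltrafilter_forall_mem fun U hU => (hUs U hU).eq_zero f).mono fun l hl =>
      apply_list_sum_eq_zero hl
  have := h.eventually_norm_sum_le hδ hφ (fun x => by simpa using hφx x) one_pos
    norm_radialRetraction_le_one Us <| .of_forall fun l =>
      ((hker (φ (l.map radialRetraction).sum)).and hball).mono fun l' hl' => by
        rw [hl'.2, hl'.1]
  refine (this.and hball).mono fun l hl => ?_
  rw [hl.2, mul_one] at hl
  exact hl.1

/-- If the subspace player does not control sums, then a losing move exists along a weakly null
ultrafilter. -/
lemma exists_isWeaklyNullInBall_of_not_sumBoundGame {C : ℝ} {n : ℕ} {v : X}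
    (h : ¬ SumBoundGame C (n + 1) v) :
    ∃ U : Ultrafilter X, IsWeaklyNullInBall U ∧
      ∀ᶠ u in (U : Filter X), ¬ SumBoundGame C n (v + u) := by
  simp only [SumBoundGame] at h
  push Not at h
  let A : {V : Submodule ℝ X // FinCodimClosed V} → Filter X := fun V =>
    𝓟 {u | u ∈ V.1 ∧ ‖u‖ ≤ 1 ∧ ¬ SumBoundGame C n (v + u)}
  have hdir : Directed (· ≥ ·) A := fun V W => by
    refine ⟨⟨V.1 ⊓ W.1, V.2.inf W.2⟩, ?_, ?_⟩
    · exact principal_mono.2 fun x hx => ⟨hx.1.1, hx.2⟩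
    · exact principal_mono.2 fun x hx => ⟨hx.1.2, hx.2⟩
  have : Nonempty {V : Submodule ℝ X // FinCodimClosed V} := ⟨⟨⊤, finCodimClosed_top⟩⟩
  have : NeBot (iInf A) := iInf_neBot_of_directed hdir fun V => by
    obtain ⟨u, hu⟩ := h V.1 V.2
    exact principal_neBot_iff.2 ⟨u, hu⟩
  have hle : ∀ V : Submodule ℝ X, FinCodimClosed V →
      ∀ᶠ u in (Ultrafilter.of (iInf A) : Filter X),
        u ∈ V ∧ ‖u‖ ≤ 1 ∧ ¬ SumBoundGame C n (v + u) := fun V hV =>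
    (Ultrafilter.of_le _).trans (iInf_le A ⟨V, hV⟩) (mem_principal_self _)
  refine ⟨Ultrafilter.of (iInf A), ⟨?_, fun f => ?_⟩, ?_⟩
  · exact (hle ⊤ finCodimClosed_top).mono fun u hu => hu.2.1
  · exact (hle _ (finCodimClosed_ker f)).mono fun u hu => hu.1
  · exact (hle ⊤ finCodimClosed_top).mono fun u hu => hu.2.2

/-- Weakly null ultrafilters following the losing positions of the game, and functionals norming
the final positions, extended to all positions by weak-star limits. -/
lemma exists_losing_ultrafilters (C : ℝ) {φ : X → StrongDual ℝ X} (hφ : ∀ x, ‖φ x‖ ≤ 1) :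
    ∃ (U : ℕ → X → Ultrafilter X) (F : ℕ → X → StrongDual ℝ X),
      (∀ n v, IsWeaklyNullInBall (U n v)) ∧
      (∀ n v, ¬ SumBoundGame C n v →
        ∀ᶠ u in (U n v : Filter X), ¬ SumBoundGame C (n - 1) (v + u)) ∧
      F 0 = φ ∧
      ∀ n v e, Tendsto (fun u => F (n - 1) (v + u) e) (U n v) (𝓝 (F n v e)) := by
  have hU : ∀ n v, ∃ U : Ultrafilter X, IsWeaklyNullInBall U ∧ (n = 0 → U = pure 0) ∧
      (¬ SumBoundGame C n v → ∀ᶠ u in (U : Filter X), ¬ SumBoundGame C (n - 1) (v + u)) := by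
    rintro (_ | n) v
    · exact ⟨pure 0, isWeaklyNullInBall_pure_zero, fun _ => rfl, fun h => by simpa using h⟩
    · by_cases h : SumBoundGame C (n + 1) v
      · exact ⟨pure 0, isWeaklyNullInBall_pure_zero, by simp, by simp [h]⟩
      · obtain ⟨U, hU, hU'⟩ := exists_isWeaklyNullInBall_of_not_sumBoundGame h
        exact ⟨U, hU, by simp, fun _ => hU'⟩
  choose U hU hU0 hlose using hU
  have hstep : ∀ (n : ℕ) (G : X → {f : StrongDual ℝ X // ‖f‖ ≤ 1}),
      ∃ G' : X → {f : StrongDual ℝ X // ‖f‖ ≤ 1},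
        ∀ v e, Tendsto (fun u => (G (v + u)).1 e) (U (n + 1) v) (𝓝 ((G' v).1 e)) := by
    intro n G
    choose G' hG' hlim using fun v => exists_weakStar_limit (U (n + 1) v)
      (fun u => (G (v + u)).1) (.of_forall fun u => (G (v + u)).2)
    exact ⟨fun v => ⟨G' v, hG' v⟩, hlim⟩
  choose step hstep using hstep
  let F : ℕ → X → {f : StrongDual ℝ X // ‖f‖ ≤ 1} := fun n =>
    Nat.rec (fun v => ⟨φ v, hφ v⟩) step n
  refine ⟨U, fun n v => (F n v).1, hU, hlose, rfl, ?_⟩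
  rintro (_ | n) v e
  · rw [hU0 0 v rfl]
    simpa using tendsto_pure_nhds (fun u => (F 0 (v + u)).1 e) 0
  · exact hstep n (F n) v e

end WeaklyNull

section Interplay

open Topology

lemma eventually_iterUltrafilter_forall_zip {α ι : Type*} {U : ι → Ultrafilter α} {S : List ι}
    {p : ι → α → Prop} (h : ∀ i ∈ S, ∀ᶠ a in (U i : Filter α), p i a) :
    ∀ᶠ l in (iterUltrafilter (S.map U) : Filter (List α)), ∀ q ∈ S.zip l, p q.1 q.2 := by
  induction S with
  | nil => simp
  | cons i S ih =>
    rw [List.map_cons, eventually_iterUltrafilter_cons]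
    refine (h i (by simp)).mono fun a ha => ?_
    refine (ih fun j hj => h j (by simp [hj])).mono fun l hl => ?_
    rw [List.zip_cons_cons, List.forall_mem_cons]
    exact ⟨ha, hl⟩

variable {X : Type*} [NormedAddCommGroup X] [NormedSpace ℝ X]

/-- Along weakly null ultrafilters, functionals depending on one coordinate almost vanish on the
sum of the other coordinates. -/
lemma eventually_iterUltrafilter_abs_sum_sub_le {ι : Type*} {U : ι → Ultrafilter X}
    (hU : ∀ i, IsWeaklyNullInBall (U i)) {G : ι → X → StrongDual ℝ X} {F : ι → StrongDual ℝ X}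
    (hG : ∀ i e, Tendsto (fun u => G i u e) (U i) (𝓝 (F i e))) {ε : ℝ} (hε : 0 < ε)
    (S : List ι) {w : X} (hw : ∀ i ∈ S, F i w = 0) :
    ∀ᶠ l in (iterUltrafilter (S.map U) : Filter (List X)),
      ∀ q ∈ S.zip l, |G q.1 q.2 (w + l.sum - q.2)| ≤ ε := by
  induction S generalizing w with
  | nil => simp
  | cons i S ih =>
    rw [List.map_cons, eventually_iterUltrafilter_cons]
    have h1 : ∀ᶠ u in (U i : Filter X), |G i u w| < ε := by
      have := (hG i w).abs.eventually_lt_const (u := ε)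
      rw [hw i (by simp), abs_zero] at this
      exact this hε
    have h2 : ∀ᶠ u in (U i : Filter X), ∀ j ∈ S, F j u = 0 :=
      (eventually_all_finite S.finite_toSet).2 fun j _ => (hU i).eq_zero (F j)
    filter_upwards [h1, h2] with u hu1 hu2
    have h3 := eventually_iterUltrafilter_forall_mem (Us := S.map U) (p := fun x => G i u x = 0)
      fun V hV => by
        obtain ⟨j, -, rfl⟩ := List.mem_map.1 hV
        exact (hU j).eq_zero (G i u)
    have h4 := ih (w := w + u) fun j hj => by
      rw [map_add, hw j (by simp [hj]), hu2 j hj, add_zero]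
    filter_upwards [h3, h4] with l hl3 hl4
    rw [List.zip_cons_cons, List.forall_mem_cons]
    refine ⟨?_, fun q hq => ?_⟩
    · have h5 : G i u l.sum = 0 := apply_list_sum_eq_zero hl3
      simpa [add_sub_assoc, h5] using hu1.le
    · have := hl4 q hq
      rwa [List.sum_cons, ← add_assoc]

end Interplay

section Tree

open Topology

variable {X : Type*} [NormedAddCommGroup X] [NormedSpace ℝ X]

/-- Extend finitely many approximate branches `(n, v, y)` of the game by a common vector `z`. -/
lemma exists_common_extension {C D ε : ℝ} (hε : 0 < ε) {φ : X → StrongDual ℝ X}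
    {U : ℕ → X → Ultrafilter X} {F : ℕ → X → StrongDual ℝ X}
    (hU : ∀ n v, IsWeaklyNullInBall (U n v))
    (hlose : ∀ n v, ¬ SumBoundGame C n v →
      ∀ᶠ u in (U n v : Filter X), ¬ SumBoundGame C (n - 1) (v + u))
    (hF : ∀ n v e, Tendsto (fun u => F (n - 1) (v + u) e) (U n v) (𝓝 (F n v e)))
    (hD : ∀ Us : List (Ultrafilter X), (∀ U ∈ Us, IsWeaklyNullInBall U) →
      ∀ᶠ l in (iterUltrafilter Us : Filter (List X)), ‖l.sum‖ ≤ D)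
    {η : ℝ} (S : List (ℕ × X × X))
    (hS : ∀ p ∈ S, ¬ SumBoundGame C p.1 p.2.1 ∧ |F p.1 p.2.1 (p.2.2 - p.2.1)| ≤ η) :
    ∃ (z : X) (S' : List (ℕ × X × X)), ‖z‖ ≤ D ∧ (∀ p ∈ S, φ p.2.2 z = 0) ∧ S ⊆ S' ∧
      (∀ p ∈ S, ∃ v', (p.1 - 1, v', p.2.2 + z) ∈ S') ∧
      ∀ p ∈ S', ¬ SumBoundGame C p.1 p.2.1 ∧ |F p.1 p.2.1 (p.2.2 - p.2.1)| ≤ η + ε := by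
  have hlist : ∀ V ∈ S.map fun p => U p.1 p.2.1, IsWeaklyNullInBall V := fun V hV => by
    obtain ⟨p, -, rfl⟩ := List.mem_map.1 hV
    exact hU _ _
  have hφz : ∀ᶠ l in (iterUltrafilter (S.map fun p => U p.1 p.2.1) : Filter (List X)),
      ∀ p ∈ S, φ p.2.2 l.sum = 0 :=
    (eventually_all_finite S.finite_toSet).2 fun p _ =>
      (eventually_iterUltrafilter_forall_mem fun V hV =>
        (hlist V hV).eq_zero (φ p.2.2)).mono fun l hl => apply_list_sum_eq_zero hl
  have hnode : ∀ p ∈ S, ∀ᶠ u in (U p.1 p.2.1 : Filter X),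
      ¬ SumBoundGame C (p.1 - 1) (p.2.1 + u) ∧
        |F (p.1 - 1) (p.2.1 + u) (p.2.2 - p.2.1)| < η + ε / 2 := fun p hp => by
    refine (hlose _ _ (hS p hp).1).and ?_
    refine (hF p.1 p.2.1 (p.2.2 - p.2.1)).abs.eventually_lt_const ?_
    linarith [(hS p hp).2]
  have hinter := eventually_iterUltrafilter_abs_sum_sub_le
    (U := fun p : ℕ × X × X => U p.1 p.2.1) (fun p => hU _ _)
    (G := fun p u => F (p.1 - 1) (p.2.1 + u)) (F := fun p => F p.1 p.2.1)
    (fun p e => hF _ _ e) (half_pos hε) S (w := 0) (by simp)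
  obtain ⟨l, ⟨⟨⟨h1, h2⟩, h3⟩, h4⟩, h5⟩ := (((((hD _ hlist).and hφz).and
    (eventually_iterUltrafilter_forall_zip hnode)).and hinter).and
    (eventually_iterUltrafilter_length _)).exists
  rw [List.length_map] at h5
  refine ⟨l.sum, S ++ (S.zip l).map fun q => (q.1.1 - 1, q.1.2.1 + q.2, q.1.2.2 + l.sum),
    h1, h2, List.subset_append_left _ _, fun p hp => ?_, fun p hp => ?_⟩
  · obtain ⟨i, hi, rfl⟩ := List.getElem_of_mem hp
    refine ⟨S[i].2.1 + l[i], List.mem_append_right _ (List.mem_map.2 ⟨(S[i], l[i]), ?_, rfl⟩)⟩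
    exact List.mem_iff_getElem.2 ⟨i, by simp; omega, by simp⟩
  · rcases List.mem_append.1 hp with hp | hp
    · exact ⟨(hS p hp).1, (hS p hp).2.trans (by linarith)⟩
    · obtain ⟨⟨p, u⟩, hq, rfl⟩ := List.mem_map.1 hp
      obtain ⟨h6, h7⟩ := h3 _ hq
      have h8 := h4 _ hq
      refine ⟨h6, ?_⟩
      simp only [zero_add] at h6 h7 h8 ⊢
      have h9 : p.2.2 + l.sum - (p.2.1 + u) = (p.2.2 - p.2.1) + (l.sum - u) := by abel
      rw [h9, map_add]
      refine (abs_add_le _ _).trans ?_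
      linarith

/-- A single sequence containing approximate branches of the losing tree along all its increasing
finite subsequences. -/
lemma exists_seq_of_not_sumBoundGame {C D : ℝ} {k : ℕ} {φ : X → StrongDual ℝ X}
    (hφ : ∀ x, ‖φ x‖ ≤ 1)
    (hD : ∀ Us : List (Ultrafilter X), (∀ U ∈ Us, IsWeaklyNullInBall U) →
      ∀ᶠ l in (iterUltrafilter Us : Filter (List X)), ‖l.sum‖ ≤ D)
    (hC : ¬ SumBoundGame C k (0 : X)) :
    ∃ z : ℕ → X, (∀ m, ‖z m‖ ≤ D) ∧ ∀ l : List ℕ, l.Pairwise (· < ·) →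
      (∀ᶠ m in atTop, φ (l.map z).sum (z m) = 0) ∧
      (l.length = k → ∃ v, C < ‖v‖ ∧ |φ v ((l.map z).sum - v)| ≤ 1) := by
  obtain ⟨U, F, hU, hlose, hF0, hF⟩ := exists_losing_ultrafilters C hφ
  let Inv : ℕ → ℕ × X × X → Prop := fun m p =>
    ¬ SumBoundGame C p.1 p.2.1 ∧ |F p.1 p.2.1 (p.2.2 - p.2.1)| ≤ 1 - (1 / 2) ^ m
  have hstage : ∀ (m : ℕ) (S : {S : List (ℕ × X × X) // ∀ p ∈ S, Inv m p}),
      ∃ (z : X) (S' : {S' : List (ℕ × X × X) // ∀ p ∈ S', Inv (m + 1) p}), ‖z‖ ≤ D ∧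
        (∀ p ∈ S.1, φ p.2.2 z = 0) ∧ S.1 ⊆ S'.1 ∧
        ∀ p ∈ S.1, ∃ v', (p.1 - 1, v', p.2.2 + z) ∈ S'.1 := by
    rintro m ⟨S, hS⟩
    obtain ⟨z, S', h1, h2, h3, h4, h5⟩ := exists_common_extension (ε := (1 / 2) ^ (m + 1))
      (φ := φ) (by positivity) hU hlose hF hD S hS
    refine ⟨z, ⟨S', fun p hp => ⟨(h5 p hp).1, (h5 p hp).2.trans_eq ?_⟩⟩, h1, h2, h3, h4⟩
    ring
  choose z' S' hz' hφz' hsub' hchild' using hstage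
  let S : (m : ℕ) → {S : List (ℕ × X × X) // ∀ p ∈ S, Inv m p} := fun m =>
    Nat.rec ⟨[(k, 0, 0)], by simpa [Inv] using hC⟩ S' m
  let z : ℕ → X := fun m => z' m (S m)
  have hmono : ∀ m M, m ≤ M → (S m).1 ⊆ (S M).1 := fun m M h =>
    monotone_nat_of_le_succ (f := fun m => {p | p ∈ (S m).1}) (fun m => hsub' m (S m)) h
  have hpath : ∀ (l : List ℕ) (m M n : ℕ) (v y : X), l.Pairwise (· < ·) → (∀ a ∈ l, m ≤ a) →
      (∀ a ∈ l, a < M) → m ≤ M → (n, v, y) ∈ (S m).1 →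
      ∃ v', (n - l.length, v', y + (l.map z).sum) ∈ (S M).1 := by
    intro l
    induction l with
    | nil => exact fun m M n v y _ _ _ hmM h => ⟨v, by simpa using hmono m M hmM h⟩
    | cons a l ih =>
      intro m M n v y hl hml hlM hmM h
      rw [List.pairwise_cons] at hl
      rw [List.forall_mem_cons] at hml hlM
      obtain ⟨v', hv'⟩ := hchild' a (S a) _ (hmono m a hml.1 h)
      obtain ⟨v'', hv''⟩ := ih (a + 1) M (n - 1) v' (y + z a) hl.2 hl.1 hlM.2 hlM.1 hv'
      refine ⟨v'', ?_⟩
      rwa [List.length_cons, List.map_cons, List.sum_cons, ← add_assoc, add_comm l.length,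
        ← Nat.sub_sub]
  refine ⟨z, fun m => hz' m (S m), fun l hl => ?_⟩
  obtain ⟨M, hM⟩ : ∃ M, ∀ a ∈ l, a < M :=
    ⟨l.sum + 1, fun a ha => Nat.lt_succ_of_le (List.single_le_sum (by simp) a ha)⟩
  obtain ⟨v, hv⟩ := hpath l 0 M k 0 0 hl (by simp) hM (by simp) (by simp [S])
  rw [zero_add] at hv
  refine ⟨(eventually_ge_atTop M).mono fun m hm => hφz' m (S m) _ (hmono M m hm hv), ?_⟩
  rintro rfl
  obtain ⟨h1, h2⟩ := (S M).2 _ hv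
  rw [Nat.sub_self, hF0] at *
  refine ⟨v, not_le.1 h1, h2.trans ?_⟩
  linarith [show (0 : ℝ) ≤ (1 / 2) ^ M by positivity]

lemma eventually_iterUltrafilter_hyperfilter (k m : ℕ) :
    ∀ᶠ l in (iterUltrafilter (List.replicate k (hyperfilter ℕ)) : Filter (List ℕ)),
      l.Pairwise (· < ·) ∧ ∀ a ∈ l, m ≤ a := by
  induction k generalizing m with
  | zero => simp
  | succ k ih =>
    rw [List.replicate_succ, eventually_iterUltrafilter_cons]
    refine ((eventually_ge_atTop m).filter_mono Nat.hyperfilter_le_atTop).mono fun a ha => ?_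
    refine (ih (a + 1)).mono fun l hl => ⟨List.pairwise_cons.2 ⟨hl.2, hl.1⟩, ?_⟩
    exact List.forall_mem_cons.2 ⟨ha, fun b hb => ha.trans ((Nat.le_succ a).trans (hl.2 b hb))⟩

/-- Concentration of Hamming-Lipschitz maps implies control of sums. -/
lemma exists_forall_sumBoundGame {δ : ℝ} (hδ : 0 < δ) (hX : ConcentratesOn X X (1 / 2) δ)
    (hN : ConcentratesOn ℕ X (1 / 2) δ) :
    ∃ C : ℝ, ∀ k, SumBoundGame C k (0 : X) := by
  choose φ hφ hφx using fun x : X => exists_dual_vector'' ℝ x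
  replace hφx : ∀ x, φ x x = ‖x‖ := fun x => by simpa using hφx x
  refine ⟨2 / δ * (2 / δ) + 1, fun k => ?_⟩
  by_contra hC
  obtain ⟨z, hz, hz'⟩ := exists_seq_of_not_sumBoundGame hφ
    (fun Us hUs => hX.eventually_norm_sum_le_of_isWeaklyNullInBall hδ hUs) hC
  have hlen := eventually_iterUltrafilter_length (List.replicate k (hyperfilter ℕ))
  have hsum := hN.eventually_norm_sum_le hδ hφ hφx (by positivity) hz
    (List.replicate k (hyperfilter ℕ)) <|
      (eventually_iterUltrafilter_hyperfilter k 0).mono fun l hl => by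
        obtain ⟨m, hm⟩ := eventually_atTop.1 (hz' l hl.1).1
        refine (eventually_iterUltrafilter_hyperfilter k m).mono fun l' hl' => ?_
        refine apply_list_sum_eq_zero fun x hx => ?_
        obtain ⟨a, ha, rfl⟩ := List.mem_map.1 hx
        exact hm a (hl'.2 a ha)
  obtain ⟨l, ⟨h1, h2⟩, h3⟩ := ((hlen.and hsum).and
    (eventually_iterUltrafilter_hyperfilter k 0)).exists
  obtain ⟨v, hv, hv'⟩ := (hz' l h3.1).2 (by simpa using h1)
  rw [map_sub, hφx] at hv'
  have h4 := (le_abs_self _).trans ((φ v).le_of_opNorm_le (hφ v) (l.map z).sum)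
  rw [one_mul] at h4
  linarith [(abs_le.1 hv').1]

end Tree

section Game

variable {X : Type*} [NormedAddCommGroup X] [NormedSpace ℝ X]

lemma EquivLinftyBasis.norm_sum_le {C : ℝ} (hC : 0 ≤ C) {k : ℕ} {x : Fin k → X}
    (hx : EquivLinftyBasis C x) (hx1 : ∀ i, ‖x i‖ = 1) {a : Fin k → ℝ} (ha : ∀ i, |a i| ≤ 1) :
    ‖∑ i, a i • x i‖ ≤ C := by
  obtain ⟨A, B, hA, hB, hAB, h⟩ := hx
  rcases isEmpty_or_nonempty (Fin k) with _ | ⟨⟨i⟩⟩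
  · simpa using hC
  have hsup : (1 : ℝ) ≤ ⨆ j, |(Pi.single i 1 : Fin k → ℝ) j| := by
    simpa using le_ciSup (f := fun j => |(Pi.single i 1 : Fin k → ℝ) j|) (Finite.bddAbove_range _) i
  have hA1 : 1 ≤ A := by
    have h1 := (h (Pi.single i 1)).1
    have h2 : ∑ j, (Pi.single i 1 : Fin k → ℝ) j • x j = x i := by
      rw [Finset.sum_eq_single i] <;> simp +contextual
    rw [h2, hx1, one_div, inv_mul_le_iff₀ hA, mul_one] at h1
    linarith
  have hsup' : ⨆ j, |a j| ≤ 1 := Real.iSup_le ha zero_le_one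
  have := (h a).2
  nlinarith

lemma SumBoundGame.of_finiteDimensional [FiniteDimensional ℝ X] {C : ℝ} {v : X} (hv : ‖v‖ ≤ C)
    (n : ℕ) : SumBoundGame C n v := by
  induction n with
  | zero => exact hv
  | succ n ih =>
    refine ⟨⊥, ⟨by simp, inferInstance⟩, fun u hu _ => ?_⟩
    rwa [(Submodule.mem_bot ℝ).1 hu, add_zero]

/-- Unit vectors suffice to describe the unit ball of a finite-codimensional subspace of an
infinite-dimensional space. -/
lemma FinCodimClosed.exists_eq_smul (hX : ¬ FiniteDimensional ℝ X) {V : Submodule ℝ X}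
    (hV : FinCodimClosed V) {u : X} (hu : u ∈ V) (hu1 : ‖u‖ ≤ 1) :
    ∃ y ∈ V, ‖y‖ = 1 ∧ ∃ c : ℝ, |c| ≤ 1 ∧ u = c • y := by
  have hunit : ∀ w ∈ V, w ≠ 0 → ‖w‖⁻¹ • w ∈ V ∧ ‖‖w‖⁻¹ • w‖ = 1 := fun w hw h0 =>
    ⟨V.smul_mem _ hw, by simp [norm_smul, h0]⟩
  by_cases h0 : u = 0
  · have hbot : V ≠ ⊥ := by
      rintro rfl
      exact hX ((Module.Finite.iff_cofg_bot ℝ X).1 hV.2)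
    obtain ⟨w, hw, hw0⟩ := V.ne_bot_iff.1 hbot
    obtain ⟨h1, h2⟩ := hunit w hw hw0
    exact ⟨_, h1, h2, 0, by simp, by simp [h0]⟩
  · obtain ⟨h1, h2⟩ := hunit u hu h0
    exact ⟨_, h1, h2, ‖u‖, by simpa using hu1, by rw [smul_inv_smul₀ (norm_ne_zero_iff.2 h0)]⟩

lemma sumBoundGame_of_strategy (hX : ¬ FiniteDimensional ℝ X) {C : ℝ} (hC : 0 ≤ C) {k : ℕ}
    {σ : (Σ i : Fin k, (Fin i.1 → X)) → Submodule ℝ X} (hσ : ∀ p, FinCodimClosed (σ p))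
    (hwin : ∀ x : Fin k → X,
      (∀ i : Fin k, ‖x i‖ = 1 ∧ x i ∈ σ ⟨i, fun j => x ⟨j.1, j.2.trans i.2⟩⟩) →
      EquivLinftyBasis C x) (n i : ℕ) (hi : i + n = k) (x : ℕ → X) (a : ℕ → ℝ)
    (hx : ∀ (j : ℕ) (hj : j < i), ‖x j‖ = 1 ∧
      x j ∈ σ ⟨⟨j, hj.trans_le (hi ▸ Nat.le_add_right i n)⟩, fun t => x t⟩)
    (ha : ∀ j < i, |a j| ≤ 1) :
    SumBoundGame C n (∑ j ∈ range i, a j • x j) := by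
  induction n generalizing i x a with
  | zero =>
    obtain rfl : i = k := hi
    have := (hwin (fun j => x j) fun j => hx j j.2).norm_sum_le hC (fun j => (hx j j.2).1)
      (a := fun j => a j) fun j => ha j j.2
    rwa [Fin.sum_univ_eq_sum_range (fun j => a j • x j)] at this
  | succ n ih =>
    have hik : i < k := by omega
    refine ⟨σ ⟨⟨i, hik⟩, fun t => x t⟩, hσ _, fun u hu hu1 => ?_⟩
    obtain ⟨y, hy, hy1, c, hc, rfl⟩ := (hσ _).exists_eq_smul hX hu hu1
    have hne : ∀ j < i, Function.update x i y j = x j := fun j hj =>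
      Function.update_of_ne hj.ne _ _
    have hpre : ∀ j ≤ i, (fun t : Fin j => Function.update x i y t) = fun t : Fin j => x t :=
      fun j hj => funext fun t => hne _ (t.2.trans_le hj)
    have := ih (i + 1) (by omega) (Function.update x i y) (Function.update a i c)
      (fun j hj => by
        rw [hpre j (Nat.lt_succ_iff.1 hj)]
        rcases Nat.lt_succ_iff_lt_or_eq.1 hj with hj | rfl
        · rw [hne j hj]
          exact hx j hj
        · rw [Function.update_self]
          exact ⟨hy1, hy⟩)
      (fun j hj => by
        rcases Nat.lt_succ_iff_lt_or_eq.1 hj with hj | rfl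
        · rw [Function.update_of_ne hj.ne]
          exact ha j hj
        · rwa [Function.update_self])
    rw [sum_range_succ, Function.update_self, Function.update_self] at this
    convert this using 2
    refine sum_congr rfl fun j hj => ?_
    rw [hne j (mem_range.1 hj), Function.update_of_ne (mem_range.1 hj).ne]

/-- In an asymptotic-`c₀` space the subspace player controls sums. -/
lemma AsymptoticC0.exists_forall_sumBoundGame (hX : AsymptoticC0 X) :
    ∃ C : ℝ, 0 ≤ C ∧ ∀ k, SumBoundGame C k (0 : X) := by
  obtain ⟨C, hC, h⟩ := hX
  refine ⟨C + 1, by linarith, fun k => ?_⟩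
  by_cases hfin : FiniteDimensional ℝ X
  · exact .of_finiteDimensional (by simp; linarith) k
  · obtain ⟨σ, hσ, hwin⟩ := h k 1 one_pos
    simpa using sumBoundGame_of_strategy hfin (by linarith) hσ hwin k 0 (by simp) 0 0
      (by simp) (by simp)

end Game

section Strategy

variable {X : Type*} [NormedAddCommGroup X] [NormedSpace ℝ X]

/-- The subspace player can force the goal `P` in `n` further rounds from the position `p`. -/
def WinsFrom (P : ∀ i, (Fin i → X) → Prop) : ℕ → ∀ i, (Fin i → X) → Prop
  | 0, i, p => P i p
  | n + 1, i, p => ∃ V : Submodule ℝ X, FinCodimClosed V ∧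
      ∀ u ∈ V, ‖u‖ = 1 → WinsFrom P n (i + 1) (Fin.snoc p u : Fin (i + 1) → X)

lemma WinsFrom.exists_strategy {P : ∀ i, (Fin i → X) → Prop} {k : ℕ}
    (h : WinsFrom P k 0 Fin.elim0) :
    ∃ σ : (Σ i : Fin k, (Fin i.1 → X)) → Submodule ℝ X,
      (∀ p, FinCodimClosed (σ p)) ∧
      ∀ x : Fin k → X,
        (∀ i : Fin k, ‖x i‖ = 1 ∧ x i ∈ σ ⟨i, fun j => x ⟨j.1, j.2.trans i.2⟩⟩) → P k x := by
  have hV : ∀ (n i : ℕ) (p : Fin i → X), ∃ V : Submodule ℝ X, FinCodimClosed V ∧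
      (WinsFrom P (n + 1) i p →
        ∀ u ∈ V, ‖u‖ = 1 → WinsFrom P n (i + 1) (Fin.snoc p u : Fin (i + 1) → X)) := by
    intro n i p
    by_cases hp : WinsFrom P (n + 1) i p
    · obtain ⟨V, hV, hV'⟩ := hp
      exact ⟨V, hV, fun _ => hV'⟩
    · exact ⟨⊤, finCodimClosed_top, fun h => absurd h hp⟩
  choose V hV hwin using hV
  refine ⟨fun p => V (k - p.1 - 1) p.1 p.2, fun p => hV _ _ _, fun x hx => ?_⟩
  have key : ∀ (i : ℕ) (hi : i ≤ k),
      WinsFrom P (k - i) i fun j : Fin i => x ⟨j.1, j.2.trans_le hi⟩ := by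
    intro i
    induction i with
    | zero =>
      intro _
      rwa [Nat.sub_zero, Subsingleton.elim (fun j : Fin 0 => _) Fin.elim0]
    | succ i ih =>
      intro hi
      have h1 := ih (Nat.le_of_succ_le hi)
      rw [show k - i = (k - i - 1) + 1 by omega] at h1
      have h2 := hwin _ _ _ h1 _ (hx ⟨i, hi⟩).2 (hx ⟨i, hi⟩).1
      rw [← Nat.sub_sub]
      convert h2 using 1
      funext j
      refine Fin.lastCases ?_ (fun j => ?_) j
      · rw [Fin.snoc_last]; rfl
      · rw [Fin.snoc_castSucc]; rfl
  have := key k le_rfl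
  rwa [Nat.sub_self] at this

/-- The vectors with coordinates `1` and `-1`. -/
def signVectors (i : ℕ) : Set (Fin i → ℝ) := Set.univ.pi fun _ => {1, -1}

lemma finite_signVectors (i : ℕ) : (signVectors i).Finite :=
  Set.Finite.pi fun _ => Set.toFinite _

lemma norm_sum_le_of_signVectors {D : ℝ} {i : ℕ} {p : Fin i → X}
    (h : ∀ a ∈ signVectors i, ‖∑ j, a j • p j‖ ≤ D) {a : Fin i → ℝ} (ha : ∀ j, |a j| ≤ 1) :
    ‖∑ j, a j • p j‖ ≤ D := by
  have hconv : Convex ℝ {a : Fin i → ℝ | ‖∑ j, a j • p j‖ ≤ D} := by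
    have := (convex_closedBall (0 : X) D).is_linear_preimage
      (Fintype.linearCombination ℝ p).isLinear
    simpa [Set.preimage, Fintype.linearCombination_apply] using this
  refine convexHull_min (s := signVectors i) h hconv ?_
  rw [signVectors, convexHull_pi]
  intro j _
  rw [convexHull_pair, segment_symm, segment_eq_Icc (by norm_num)]
  exact abs_le.1 (ha j)

/-- The coordinate functionals of `p` are bounded by some constant less than `3`. -/
def HasSmallCoordinates (i : ℕ) (p : Fin i → X) : Prop :=
  ∃ c : ℝ, 1 ≤ c ∧ c < 3 ∧ ∀ (a : Fin i → ℝ) (j : Fin i), |a j| ≤ c * ‖∑ j, a j • p j‖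

lemma HasSmallCoordinates.exists_snoc {i : ℕ} {p : Fin i → X} (hp : HasSmallCoordinates i p) :
    ∃ V : Submodule ℝ X, FinCodimClosed V ∧ ∀ u ∈ V, ‖u‖ = 1 →
      HasSmallCoordinates (i + 1) (Fin.snoc p u : Fin (i + 1) → X) := by
  obtain ⟨c, hc1, hc3, hc⟩ := hp
  obtain ⟨s, hs1, hs⟩ := exists_between (lt_min one_lt_two ((one_lt_div₀ (by positivity)).2 hc3))
  have hs2 : s < 2 := hs.trans_le (min_le_left _ _)
  have hsc : s * c < 3 := (lt_div_iff₀ (by positivity)).1 (hs.trans_le (min_le_right _ _))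
  have hs0 : 0 < s := by linarith
  let E := Submodule.span ℝ (Set.range p)
  have : FiniteDimensional ℝ E := .span_of_finite ℝ (Set.finite_range p)
  obtain ⟨V, hV, hVE⟩ := exists_finCodimClosed_norm_le E
    (η := 1 - s⁻¹) (sub_pos.2 (inv_lt_one_of_one_lt₀ hs1))
  refine ⟨V, hV, fun u hu hu1 => ⟨max (s * c) (1 + s), ?_, max_lt hsc (by linarith), ?_⟩⟩
  · exact le_max_of_le_right (by linarith)
  intro a j
  rw [Fin.sum_univ_castSucc]
  simp only [Fin.snoc_castSucc, Fin.snoc_last]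
  set e := ∑ j : Fin i, a j.castSucc • p j with he
  have heE : e ∈ E := Submodule.sum_mem _ fun j _ =>
    E.smul_mem _ (Submodule.subset_span ⟨j, rfl⟩)
  have h1 := hVE e heE _ (V.smul_mem (a (Fin.last i)) hu)
  rw [sub_sub_cancel, inv_mul_le_iff₀ hs0] at h1
  have h0 := norm_nonneg (e + a (Fin.last i) • u)
  refine Fin.lastCases ?_ (fun j => ?_) j
  · have h2 : ‖a (Fin.last i) • u‖ = |a (Fin.last i)| := by
      rw [norm_smul, hu1, mul_one, Real.norm_eq_abs]
    have h3 := norm_sub_le (e + a (Fin.last i) • u) e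
    rw [add_sub_cancel_left, h2] at h3
    refine le_trans ?_ (mul_le_mul_of_nonneg_right (le_max_right _ _) h0)
    linarith
  · refine le_trans ?_ (mul_le_mul_of_nonneg_right (le_max_left _ _) h0)
    have h2 := hc (fun j => a j.castSucc) j
    rw [← he] at h2
    nlinarith

lemma winsFrom_of_sumBoundGame {D : ℝ} (n i : ℕ) (p : Fin i → X)
    (hD : ∀ a ∈ signVectors i, SumBoundGame D n (∑ j, a j • p j))
    (hp : HasSmallCoordinates i p) :
    WinsFrom (fun i p => (∀ a ∈ signVectors i, ‖∑ j, a j • p j‖ ≤ D) ∧ HasSmallCoordinates i p)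
      n i p := by
  induction n generalizing i with
  | zero => exact ⟨hD, hp⟩
  | succ n ih =>
    have hD' : ∀ a ∈ signVectors i, ∃ V : Submodule ℝ X, FinCodimClosed V ∧
        ∀ u ∈ V, ‖u‖ ≤ 1 → SumBoundGame D n (∑ j, a j • p j + u) := hD
    obtain ⟨V, hV, hVD⟩ := exists_finCodimClosed_forall_mem (finite_signVectors i) hD'
    obtain ⟨W, hW, hWp⟩ := hp.exists_snoc
    refine ⟨V ⊓ W, hV.inf hW, fun u hu hu1 => ih _ _ (fun a ha => ?_) (hWp u hu.2 hu1)⟩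
    rw [Fin.sum_univ_castSucc]
    simp only [Fin.snoc_castSucc, Fin.snoc_last]
    refine hVD (fun j => a j.castSucc) (fun j _ => ha _ trivial) _ (V.smul_mem _ hu.1) ?_
    rcases ha (Fin.last i) trivial with h | h
    · simp [h, hu1]
    · simp [Set.mem_singleton_iff.1 h, hu1]

/-- A space in which the subspace player controls sums is asymptotic-`c₀`. -/
lemma asymptoticC0_of_sumBoundGame {D : ℝ} (h : ∀ k, SumBoundGame D k (0 : X)) :
    AsymptoticC0 X := by
  have hB : 1 ≤ max D 1 := le_max_right _ _
  refine ⟨3 * max D 1, by linarith, fun k ε hε => ?_⟩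
  obtain ⟨σ, hσ, hwin⟩ := (winsFrom_of_sumBoundGame (D := D) k 0 Fin.elim0
    (fun a _ => by simpa using h k) ⟨1, le_rfl, by norm_num, fun a j => j.elim0⟩).exists_strategy
  refine ⟨σ, hσ, fun x hx => ?_⟩
  obtain ⟨hup, c, -, hc, hlow⟩ := hwin x hx
  refine ⟨3, max D 1, by norm_num, by linarith, by linarith, fun a => ⟨?_, ?_⟩⟩
  · have h0 := norm_nonneg (∑ i, a i • x i)
    have : ⨆ i, |a i| ≤ 3 * ‖∑ i, a i • x i‖ := Real.iSup_le (fun i => by nlinarith [hlow a i])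
      (by positivity)
    linarith
  · set M := ⨆ i, |a i|
    have hM : ∀ i, |a i| ≤ M := le_ciSup (f := fun i => |a i|) (Finite.bddAbove_range _)
    have hM0 : 0 ≤ M := Real.iSup_nonneg fun i => abs_nonneg _
    rcases hM0.eq_or_lt with h0 | h0
    · have : ∀ i, a i = 0 := fun i => abs_nonpos_iff.1 (h0 ▸ hM i)
      simp [this, ← h0]
    · have h1 := norm_sum_le_of_signVectors hup (a := fun i => M⁻¹ * a i) fun i => by
        rw [abs_mul, abs_inv, abs_of_pos h0, inv_mul_le_iff₀ h0, mul_one]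
        exact hM i
      simp only [mul_smul, ← smul_sum] at h1
      rw [norm_smul, norm_inv, Real.norm_of_nonneg hM0, inv_mul_le_iff₀ h0, mul_comm] at h1
      exact h1.trans (by gcongr; exact le_max_left _ _)

end Strategy

/-- if `Y` is a reflexive asymptotic-`c₀` Banach space and the closed unit ball
of the Banach space `X` uniformly embeds into `Y`, then `X` is reflexive and
asymptotic-`c₀`. -/
theorem statement_8 {X Y : Type*} [NormedAddCommGroup X] [NormedSpace ℝ X] [CompleteSpace X]
    [NormedAddCommGroup Y] [NormedSpace ℝ Y] [CompleteSpace Y]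
    (hYrefl : IsReflexiveSpace Y) (hYc0 : AsymptoticC0 Y)
    (hemb : ∃ g : (Metric.closedBall (0 : X) 1) → Y, UniformEmbeddingMap g) :
    IsReflexiveSpace X ∧ AsymptoticC0 X := by
  obtain ⟨g, hg⟩ := hemb
  obtain ⟨C, hC0, hC⟩ := hYc0.exists_forall_sumBoundGame
  constructor
  · refine isReflexiveSpace_of_concentratesOn fun t ht => ?_
    obtain ⟨δ, hδ, h, -⟩ := hg.exists_concentratesOn hYrefl hC0 hC ht X ℕ
    exact ⟨δ, hδ, h⟩
  · obtain ⟨δ, hδ, hX, hN⟩ := hg.exists_concentratesOn hYrefl hC0 hC one_half_pos X ℕ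
    obtain ⟨D, hD⟩ := exists_forall_sumBoundGame hδ hX hN
    exact asymptoticC0_of_sumBoundGame hD
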